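/- arXiv:2309.17181 — 2 statements merged into one kernel-verified Lean document; each statement's English description precedes it below -/
import Mathlib

section
/- Let k ≥ 1 be an integer and let z, c be complex numbers with c ≠ 0, c^i ≠ 1 for all 1 ≤ i ≤ k, and z ≠ c^m for all integers 0 ≤ m ≤ 2k−2. Then Σ_{j=0}^{k} (−1)^j c^{−j(2k−j−1)/2} / [(c;c)_j · (c;c)_{k−j} · (z c^{−2(j−1)};c)_j · (z c^{−k−j+1};c)_{k−j}] = 0. (Lemma 5.2.4, a q-analogue of Σ_j (−1)^j C(k,j) = 0.) -/
open Finset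

/-- The q-Pochhammer symbol `(x;c)_m = ∏_{i=0}^{m-1} (1 - c^i x)`. -/
noncomputable def qPoch (x c : ℂ) (m : ℕ) : ℂ := ∏ i ∈ Finset.range m, (1 - c ^ i * x)

theorem qPoch_add' (x c : ℂ) (a b : ℕ) :
    qPoch x c (a + b) = qPoch x c a * qPoch (c ^ a * x) c b := by
  unfold qPoch
  rw [Finset.prod_range_add]
  congr 1
  apply Finset.prod_congr rfl
  intro i _
  ring

theorem qPoch_one' (x c : ℂ) : qPoch x c 1 = 1 - x := by
  simp [qPoch]

theorem qPoch_succ' (c : ℂ) (a : ℕ) :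
    qPoch c c (a + 1) = qPoch c c a * (1 - c ^ (a + 1)) := by
  rw [qPoch_add', qPoch_one', pow_succ]

theorem expo_step (m r : ℕ) :
    (m + 1) * (2 * (m + 1 + r) - (m + 1) - 1) / 2 = m * (2 * (m + 1 + r) - m - 1) / 2 + r := by
  have h1 : 2 * (m + 1 + r) - (m + 1) - 1 = m + 2 * r := by omega
  have h2 : 2 * (m + 1 + r) - m - 1 = m + 1 + 2 * r := by omega
  rw [h1, h2]
  have : (m + 1) * (m + 2 * r) = m * (m + 1 + 2 * r) + r * 2 := by ring
  rw [this, Nat.add_mul_div_right _ _ (by norm_num)]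

theorem step_alg (m s : ℕ) (x c e Qm Qs : ℂ) (hc : c ≠ 0) (hQm : Qm ≠ 0) (hQs : Qs ≠ 0)
    (hm : 1 - c ^ (m + 1) ≠ 0) (hs : 1 - c ^ (s + 1) ≠ 0) (hk : 1 - c ^ (m + s + 2) ≠ 0)
    (P P' A B G : ℂ) (hG : G ≠ 0) (h1 : G = (1 - x) * P') (h2 : G = P * (1 - c ^ (m + s + 2) * x))
    (h3 : G = B * (1 - c ^ (s + 1) * x) * A) :
    e / ((1 - c ^ (m + s + 2)) * Qm * (Qs * (1 - c ^ (s + 1))) * P') +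
      -(e * (c ^ (s + 1))⁻¹) / ((Qm * (1 - c ^ (m + 1))) * (Qs * (1 - c ^ (s + 1))) * A * B) =
    -(e * (c ^ (s + 1))⁻¹) / ((1 - c ^ (m + s + 2)) * (Qm * (1 - c ^ (m + 1))) * Qs * P) := by
  have n1 : 1 - x ≠ 0 := by rintro h; simp [h] at h1; exact hG h1
  have n2 : 1 - c ^ (m + s + 2) * x ≠ 0 := by rintro h; simp [h] at h2; exact hG h2
  have n3 : 1 - c ^ (s + 1) * x ≠ 0 := by rintro h; simp [h] at h3; exact hG h3
  have e1 : P'⁻¹ = (1 - x) * G⁻¹ := by rw [h1, mul_inv]; field_simp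
  have e2 : P⁻¹ = (1 - c ^ (m + s + 2) * x) * G⁻¹ := by rw [h2, mul_inv]; field_simp
  have e3 : A⁻¹ * B⁻¹ = (1 - c ^ (s + 1) * x) * G⁻¹ := by
    rw [h3, mul_inv, mul_inv]; field_simp
  have l2 : (Qm * (1 - c ^ (m + 1))) * (Qs * (1 - c ^ (s + 1))) * A * B =
    (Qm * (1 - c ^ (m + 1))) * (Qs * (1 - c ^ (s + 1))) * (A * B) := by ring
  rw [l2]
  simp only [div_eq_mul_inv]
  rw [mul_inv _ P', mul_inv _ P, mul_inv _ (A * B), mul_inv A B, e1, e2, e3]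
  have hp : c ^ (m + s + 2) = c ^ (m + 1) * c ^ (s + 1) := by ring
  rw [hp] at hk ⊢
  have hcs : c ^ (s + 1) ≠ 0 := pow_ne_zero _ hc
  generalize c ^ (m + 1) = u at *
  generalize c ^ (s + 1) = v at *
  field_simp
  ring

theorem partial_sum (k : ℕ) (z c : ℂ) (hc : c ≠ 0)
    (hc1 : ∀ i : ℕ, 1 ≤ i → i ≤ k → c ^ i ≠ 1)
    (hz : ∀ m : ℤ, 0 ≤ m → m ≤ 2 * (k : ℤ) - 2 → z ≠ c ^ m) (n : ℕ) (hn : n < k) :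
    ∑ j ∈ Finset.range (n + 1),
      (-1 : ℂ) ^ j * c ^ (-((j * (2 * k - j - 1) / 2 : ℕ) : ℤ)) /
        (qPoch c c j * qPoch c c (k - j) *
          qPoch (z * c ^ (-(2 * ((j : ℤ) - 1)))) c j *
          qPoch (z * c ^ ((1 : ℤ) - (k : ℤ) - (j : ℤ))) c (k - j)) =
    (-1 : ℂ) ^ n * c ^ (-((n * (2 * k - n - 1) / 2 : ℕ) : ℤ)) /
        ((1 - c ^ k) * qPoch c c n * qPoch c c (k - 1 - n) *
          qPoch (z * c ^ ((1 : ℤ) - (k : ℤ) - (n : ℤ))) c k) := by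
  have hq : ∀ i ≤ k, qPoch c c i ≠ 0 := by
    intro i hi
    unfold qPoch
    rw [Finset.prod_ne_zero_iff]
    intro a ha
    rw [Finset.mem_range] at ha
    rw [← pow_succ]
    exact sub_ne_zero.2 (hc1 (a + 1) (by omega) (by omega)).symm
  induction n with
  | zero =>
    obtain ⟨k, rfl⟩ : ∃ l, k = l + 1 := ⟨k - 1, by omega⟩
    simp [qPoch_succ', show qPoch c c 0 = 1 by simp [qPoch],
      show ∀ x, qPoch x c 0 = 1 by simp [qPoch]]
    left
    ring
  | succ m ih =>
    rw [Finset.sum_range_succ, ih (by omega)]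
    obtain ⟨s, rfl⟩ : ∃ s, k = m + s + 2 := ⟨k - m - 2, by omega⟩
    have hb := expo_step m (s + 1)
    rw [show m + 1 + (s + 1) = m + s + 2 by ring] at hb
    rw [hb]
    rw [show m + s + 2 - 1 - m = s + 1 by omega, show m + s + 2 - (m + 1) = s + 1 by omega,
      show m + s + 2 - 1 - (m + 1) = s by omega]
    set x := z * c ^ ((1 : ℤ) - ((m + s + 2 : ℕ) : ℤ) - ((m + 1 : ℕ) : ℤ)) with hx
    have hP' : z * c ^ ((1 : ℤ) - ((m + s + 2 : ℕ) : ℤ) - (m : ℤ)) = c * x := by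
      rw [hx, mul_left_comm, ← zpow_one_add₀ hc]
      congr 2; push_cast; ring
    have hA : z * c ^ (-(2 * (((m + 1 : ℕ) : ℤ) - 1))) = c ^ (s + 2) * x := by
      rw [hx, mul_left_comm, ← zpow_natCast c (s + 2), ← zpow_add₀ hc]
      congr 2; push_cast; ring
    rw [hP', hA]
    have hG : qPoch x c (m + s + 3) ≠ 0 := by
      unfold qPoch
      rw [Finset.prod_ne_zero_iff]
      intro a ha h0
      rw [Finset.mem_range] at ha
      rw [hx, mul_left_comm, ← zpow_natCast c a, ← zpow_add₀ hc, sub_eq_zero] at h0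
      apply hz (((m + s + 2 : ℕ) : ℤ) + ((m + 1 : ℕ) : ℤ) - 1 - a) (by push_cast; omega)
        (by push_cast; omega)
      rw [eq_comm, ← eq_mul_inv_iff_mul_eq₀ (zpow_ne_zero _ hc), one_mul, ← zpow_neg] at h0
      rw [h0]
      congr 1; ring
    have key := step_alg m s x c ((-1 : ℂ) ^ m * c ^ (-((m * (2 * (m + s + 2) - m - 1) / 2 : ℕ) : ℤ)))
      (qPoch c c m) (qPoch c c s) hc (hq _ (by omega)) (hq _ (by omega))
      (sub_ne_zero.2 (hc1 _ (by omega) (by omega)).symm)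
      (sub_ne_zero.2 (hc1 _ (by omega) (by omega)).symm)
      (sub_ne_zero.2 (hc1 _ (by omega) (by omega)).symm)
      (qPoch x c (m + s + 2)) (qPoch (c * x) c (m + s + 2)) (qPoch (c ^ (s + 2) * x) c (m + 1))
      (qPoch x c (s + 1)) _ hG
      (by rw [show m + s + 3 = 1 + (m + s + 2) by ring, qPoch_add', qPoch_one', pow_one])
      (by rw [show m + s + 3 = (m + s + 2) + 1 by ring, qPoch_add', qPoch_one'])
      (by rw [show m + s + 3 = (s + 1 + 1) + (m + 1) by ring, qPoch_add', qPoch_add', qPoch_one'])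
    have he : (-1 : ℂ) ^ (m + 1) *
        c ^ (-((m * (2 * (m + s + 2) - m - 1) / 2 + (s + 1) : ℕ) : ℤ)) =
        -((-1 : ℂ) ^ m * c ^ (-((m * (2 * (m + s + 2) - m - 1) / 2 : ℕ) : ℤ)) *
          (c ^ (s + 1))⁻¹) := by
      rw [Nat.cast_add, neg_add, zpow_add₀ hc, zpow_neg c ((s + 1 : ℕ) : ℤ), zpow_natCast, pow_succ]
      ring
    rw [he, qPoch_succ' c m, qPoch_succ' c s]
    exact key

/-- Lemma 5.2.4: a q-analogue of `Σ_j (−1)^j C(k,j) = 0`. -/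
theorem qBinomialLemma' (k : ℕ) (hk : 1 ≤ k) (z c : ℂ) (hc : c ≠ 0)
    (hc1 : ∀ i : ℕ, 1 ≤ i → i ≤ k → c ^ i ≠ 1)
    (hz : ∀ m : ℤ, 0 ≤ m → m ≤ 2 * (k : ℤ) - 2 → z ≠ c ^ m) :
    ∑ j ∈ Finset.range (k + 1),
      (-1 : ℂ) ^ j * c ^ (-((j * (2 * k - j - 1) / 2 : ℕ) : ℤ)) /
        (qPoch c c j * qPoch c c (k - j) *
          qPoch (z * c ^ (-(2 * ((j : ℤ) - 1)))) c j *
          qPoch (z * c ^ ((1 : ℤ) - (k : ℤ) - (j : ℤ))) c (k - j)) = 0 := by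
  obtain ⟨m, rfl⟩ : ∃ m, k = m + 1 := ⟨k - 1, by omega⟩
  rw [Finset.sum_range_succ, partial_sum (m + 1) z c hc hc1 hz m (by omega)]
  have hb := expo_step m 0
  simp only [add_zero] at hb
  rw [hb]
  have h0 : ∀ x, qPoch x c 0 = 1 := by simp [qPoch]
  have hx : ((1 : ℤ) - ((m + 1 : ℕ) : ℤ) - (m : ℤ)) = -(2 * (((m + 1 : ℕ) : ℤ) - 1)) := by
    push_cast; ring
  rw [hx, show m + 1 - 1 - m = 0 by omega, Nat.sub_self, h0, h0, qPoch_succ' c m, pow_succ (-1 : ℂ) m,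
    mul_comm (1 - c ^ (m + 1)) (qPoch c c m)]
  ring
end

section
/- Fix n ≥ 1, 0 ≤ r ≤ n, and nonzero complex numbers x₁, x₂, a, b₁, b₂ with a^m ≠ 1 for all 1 ≤ m ≤ n and x₂ b₁ ≠ x₁ b₂ a^m for every integer m with |m| ≤ n. Let ν₁ < ⋯ < ν_{n−r} and ν_{n−r+1} < ⋯ < ν_n be integers with {ν₁,…,ν_n} = {1,…,n}, and let σ ∈ S_n satisfy {σ(ν₁),…,σ(ν_{n−r})} = {1,…,n−r} and {σ(ν_{n−r+1}),…,σ(ν_n)} = {n−r+1,…,n}. Then ∏_{1≤i<j≤n} (η_{σ(i)} − a^{−1} η_{σ(j)}) ≠ 0 if and only if σ(ν_i) = i for all 1 ≤ i ≤ n. (Lemma 8.2.) -/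
open Finset

/-- The characteristic point `η = η_r ∈ ℂⁿ`: `η_i = x₁ b₁⁻¹ a^{−(i−1)}` for `1 ≤ i ≤ n−r`
and `η_{n−r+i} = x₂ b₂⁻¹ a^{−(i−1)}` for `1 ≤ i ≤ r` (indexed by `Fin n`, zero-based). -/
noncomputable def etaPt (n r : ℕ) (x₁ x₂ a b₁ b₂ : ℂ) (i : Fin n) : ℂ :=
  if (i : ℕ) < n - r then x₁ * b₁⁻¹ * (a ^ (i : ℕ))⁻¹
  else x₂ * b₂⁻¹ * (a ^ ((i : ℕ) - (n - r)))⁻¹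

theorem zpow_ne_one_aux (n : ℕ) (a : ℂ) (ha1 : ∀ m : ℕ, 1 ≤ m → m ≤ n → a ^ m ≠ 1)
    (m : ℤ) (hm : |m| ≤ (n : ℤ)) (h : a ^ m = 1) : m = 0 := by
  by_contra h0
  have h1 : a ^ m.natAbs = 1 := by
    rcases Int.natAbs_eq m with e | e
    · rw [e, zpow_natCast] at h; exact h
    · rw [e, zpow_neg, zpow_natCast, inv_eq_one] at h; exact h
  rw [abs_le] at hm
  exact ha1 m.natAbs (by omega) (by omega) h1

theorem factor_aux (n r : ℕ) (x₁ x₂ a b₁ b₂ : ℂ)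
    (hx₁ : x₁ ≠ 0) (hx₂ : x₂ ≠ 0) (ha : a ≠ 0) (hb₁ : b₁ ≠ 0) (hb₂ : b₂ ≠ 0)
    (ha1 : ∀ m : ℕ, 1 ≤ m → m ≤ n → a ^ m ≠ 1)
    (hgen : ∀ m : ℤ, |m| ≤ (n : ℤ) → x₂ * b₁ ≠ x₁ * b₂ * a ^ m) (s t : Fin n) :
    etaPt n r x₁ x₂ a b₁ b₂ s - a⁻¹ * etaPt n r x₁ x₂ a b₁ b₂ t = 0 ↔
      (s : ℕ) = t + 1 ∧ ((s : ℕ) < n - r ↔ (t : ℕ) < n - r) := by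
  have hs := s.2
  have ht := t.2
  have same : ∀ (c : ℂ) (u v : ℕ), c ≠ 0 → u < n → v < n →
      (c * (a ^ u)⁻¹ - a⁻¹ * (c * (a ^ v)⁻¹) = 0 ↔ u = v + 1) := by
    intro c u v hc hu hv
    constructor
    · intro h
      have h2 : a ^ v * a = a ^ u := by
        have h := sub_eq_zero.1 h
        field_simp at h
        linear_combination h
      have h3 : a ^ ((v : ℤ) + 1 - u) = 1 := by
        rw [zpow_sub₀ ha, zpow_add₀ ha, zpow_natCast, zpow_natCast, zpow_one, h2]
        exact div_self (pow_ne_zero _ ha)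
      have := zpow_ne_one_aux n a ha1 _ (by rw [abs_le]; omega) h3
      omega
    · rintro rfl
      rw [pow_succ, mul_inv]; ring
  unfold etaPt
  by_cases h1 : (s : ℕ) < n - r <;> by_cases h2 : (t : ℕ) < n - r
  · simp only [h1, h2, if_true]
    rw [same _ _ _ (mul_ne_zero hx₁ (inv_ne_zero hb₁)) hs ht]; simp
  · simp only [h1, h2, if_true, if_false]
    simp only [true_iff, not_true_eq_false, iff_false, and_false]
    generalize hv : (t : ℕ) - (n - r) = v
    intro h
    apply hgen ((v : ℤ) + 1 - (s : ℕ)) (by rw [abs_le]; omega)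
    rw [zpow_sub₀ ha, zpow_add₀ ha, zpow_natCast, zpow_natCast, zpow_one]
    have h := sub_eq_zero.1 h
    field_simp at h ⊢
    linear_combination -h
  · simp only [h1, h2, if_true, if_false]
    simp only [iff_true, and_false, iff_false]
    generalize hv : (s : ℕ) - (n - r) = v
    intro h
    apply hgen ((v : ℤ) - 1 - (t : ℕ)) (by rw [abs_le]; omega)
    rw [zpow_sub₀ ha, zpow_sub₀ ha, zpow_natCast, zpow_natCast, zpow_one]
    have h := sub_eq_zero.1 h
    field_simp at h ⊢
    linear_combination h
  · simp only [h1, h2, if_false]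
    rw [same _ _ _ (mul_ne_zero hx₂ (inv_ne_zero hb₂)) (by omega) (by omega)]
    simp only [and_true]
    omega

/-- Monotone on blocks from consecutive steps. -/
theorem mono_aux (n k : ℕ) (f : Fin n → Fin n)
    (h : ∀ s t : Fin n, (s : ℕ) = t + 1 → ((s : ℕ) < k ↔ (t : ℕ) < k) → f t < f s) :
    ∀ (d : ℕ) (s t : Fin n), (s : ℕ) = t + 1 + d → ((s : ℕ) < k ↔ (t : ℕ) < k) → f t < f s := by
  intro d
  induction d with
  | zero => intro s t e; exact h s t e
  | succ d ih =>
    intro s t e hb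
    have hs := s.2
    refine lt_trans (ih ⟨t + 1 + d, by omega⟩ t rfl ?_) (h s _ ?_ ?_)
    · simp only; omega
    · simp only; omega
    · simp only; omega

theorem le_aux (n k : ℕ) (f : Fin n → Fin n) (hk : ∀ i : Fin n, (i : ℕ) < k ↔ (f i : ℕ) < k)
    (h : ∀ s t : Fin n, (s : ℕ) = t + 1 → ((s : ℕ) < k ↔ (t : ℕ) < k) → f t < f s) :
    ∀ (d : ℕ) (hd : d < n), d ≤ (f ⟨d, hd⟩ : ℕ) := by
  intro d
  induction d with
  | zero => intro _; omega
  | succ d ih =>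
    intro hd
    have h0 := ih (by omega)
    by_cases hb : (d + 1 < k ↔ d < k)
    · have := h ⟨d + 1, hd⟩ ⟨d, by omega⟩ rfl hb
      rw [Fin.lt_def] at this
      omega
    · have := hk ⟨d + 1, hd⟩
      simp only at this
      omega

/-- Lemma 8.2: for a shuffle-type permutation the factor
`∏_{i<j} (η_{σ(i)} − a⁻¹ η_{σ(j)})` is nonzero iff `σ(ν_i) = i` for all `i`. -/
theorem lemma8_2 (n r : ℕ) (hn : 1 ≤ n) (hr : r ≤ n) (x₁ x₂ a b₁ b₂ : ℂ)
    (hx₁ : x₁ ≠ 0) (hx₂ : x₂ ≠ 0) (ha : a ≠ 0) (hb₁ : b₁ ≠ 0) (hb₂ : b₂ ≠ 0)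
    (ha1 : ∀ m : ℕ, 1 ≤ m → m ≤ n → a ^ m ≠ 1)
    (hgen : ∀ m : ℤ, |m| ≤ (n : ℤ) → x₂ * b₁ ≠ x₁ * b₂ * a ^ m)
    (ν : Fin n → Fin n) (hν : Function.Bijective ν)
    (hν₁ : ∀ i j : Fin n, i < j → (j : ℕ) < n - r → ν i < ν j)
    (hν₂ : ∀ i j : Fin n, n - r ≤ (i : ℕ) → i < j → ν i < ν j)
    (σ : Equiv.Perm (Fin n))
    (hσ : ∀ i : Fin n, (i : ℕ) < n - r ↔ ((σ (ν i)) : ℕ) < n - r) :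
    (∏ p ∈ Finset.univ.filter (fun p : Fin n × Fin n => p.1 < p.2),
        (etaPt n r x₁ x₂ a b₁ b₂ (σ p.1) - a⁻¹ * etaPt n r x₁ x₂ a b₁ b₂ (σ p.2))) ≠ 0
    ↔ (∀ i : Fin n, σ (ν i) = i) := by
  have key : (∏ p ∈ Finset.univ.filter (fun p : Fin n × Fin n => p.1 < p.2),
        (etaPt n r x₁ x₂ a b₁ b₂ (σ p.1) - a⁻¹ * etaPt n r x₁ x₂ a b₁ b₂ (σ p.2))) ≠ 0 ↔
      ∀ s t : Fin n, (s : ℕ) = t + 1 → ((s : ℕ) < n - r ↔ (t : ℕ) < n - r) →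
        σ.symm t < σ.symm s := by
    rw [Finset.prod_ne_zero_iff]
    constructor
    · intro h s t e hb
      by_contra hlt
      have hne : σ.symm s ≠ σ.symm t := by
        intro he
        have := σ.symm.injective he
        subst this
        omega
      have hlt' : σ.symm s < σ.symm t := lt_of_le_of_ne (not_lt.1 hlt) hne
      apply h (σ.symm s, σ.symm t) (by simp [hlt'])
      simp only [Equiv.apply_symm_apply]
      exact (factor_aux n r x₁ x₂ a b₁ b₂ hx₁ hx₂ ha hb₁ hb₂ ha1 hgen s t).2 ⟨e, hb⟩
    · intro h p hp h0
      obtain ⟨e, hb⟩ := (factor_aux n r x₁ x₂ a b₁ b₂ hx₁ hx₂ ha hb₁ hb₂ ha1 hgen _ _).1 h0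
      have := h _ _ e hb
      simp only [Equiv.symm_apply_apply] at this
      have hp' := (Finset.mem_filter.1 hp).2
      exact absurd this (not_lt.2 hp'.le)
  rw [key]
  have hνmono : ∀ s t : Fin n, (t : ℕ) < s → ((s : ℕ) < n - r ↔ (t : ℕ) < n - r) →
      ν t < ν s := by
    intro s t e hb
    by_cases hs : (s : ℕ) < n - r
    · exact hν₁ t s e hs
    · exact hν₂ t s (by omega) e
  constructor
  · intro h
    have hm := mono_aux n (n - r) σ.symm h
    have hstep : ∀ s t : Fin n, (s : ℕ) = t + 1 → ((s : ℕ) < n - r ↔ (t : ℕ) < n - r) →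
        σ (ν t) < σ (ν s) := by
      intro s t e hb
      have h1 := hνmono s t (by omega) hb
      by_contra hlt
      have hne : σ (ν s) ≠ σ (ν t) := fun he => h1.ne' (σ.injective he)
      have hlt' : σ (ν s) < σ (ν t) := lt_of_le_of_ne (not_lt.1 hlt) hne
      rw [Fin.lt_def] at hlt'
      have h2 := hm ((σ (ν t) : ℕ) - (σ (ν s) : ℕ) - 1) (σ (ν t)) (σ (ν s)) (by omega)
        (by rw [← hσ, ← hσ]; exact hb.symm)
      simp only [Equiv.symm_apply_apply] at h2
      exact lt_asymm h1 h2
    have hle := le_aux n (n - r) (fun i => σ (ν i)) hσ hstep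
    have hsum : ∑ i : Fin n, (i : ℕ) = ∑ i : Fin n, (σ (ν i) : ℕ) :=
      (Function.Bijective.sum_comp (σ.bijective.comp hν) (fun i : Fin n => (i : ℕ))).symm
    have := (Finset.sum_eq_sum_iff_of_le (fun (i : Fin n) _ => hle i i.2)).1 hsum
    intro i
    exact Fin.ext (this i (Finset.mem_univ i)).symm
  · intro h s t e hb
    have h1 := hνmono s t (by omega) hb
    have e1 : σ.symm t = ν t := by rw [Equiv.symm_apply_eq, h]
    have e2 : σ.symm s = ν s := by rw [Equiv.symm_apply_eq, h]
    rw [e1, e2]; exact h1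
end
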